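/- arXiv:1407.0643 — 4 statements merged into one kernel-verified Lean document; each statement's English description precedes it below -/
import Mathlib

section
/- Let H be a connected simple graph on n vertices, let α ≥ 0, and let σ be a Nash equilibrium of the max-distance network creation game on H such that G(σ) is connected. Then SC(σ) ≤ α·(n−1) + 2·n·ρ_{G(σ)}. -/
open scoped ENNReal Classical

namespace NCG

variable {V : Type*}

/-- A strategy profile is valid w.r.t. host graph `H` if each player only buys
edges of `H` incident to it. -/
def Valid (H : SimpleGraph V) (σ : V → Finset V) : Prop :=
  ∀ v, ∀ w ∈ σ v, H.Adj v w

/-- The graph created by a strategy profile: `u` and `v` are adjacent iff one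
of them bought the edge towards the other. -/
def created (σ : V → Finset V) : SimpleGraph V :=
  SimpleGraph.fromRel (fun u v => v ∈ σ u)

/-- Eccentricity of a vertex (`⊤` if the graph is disconnected). -/
noncomputable def ecc (G : SimpleGraph V) (v : V) : ℕ∞ :=
  ⨆ u, G.edist v u

/-- Radius of a graph. -/
noncomputable def radius (G : SimpleGraph V) : ℕ∞ :=
  ⨅ v, ecc G v

/-- The cost of player `v` under strategy profile `σ`, with edge price `α`:
`α` times the number of bought edges plus the eccentricity of `v` in the
created graph. -/
noncomputable def cost (α : ℝ) (σ : V → Finset V) (v : V) : ℝ≥0∞ :=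
  ENNReal.ofReal α * (σ v).card + (ecc (created σ) v : ℝ≥0∞)

/-- Nash equilibrium: no player can strictly decrease its own cost by
unilaterally switching to another valid strategy. -/
def IsNE [DecidableEq V] (H : SimpleGraph V) (α : ℝ) (σ : V → Finset V) : Prop :=
  Valid H σ ∧ ∀ v (s : Finset V), (∀ w ∈ s, H.Adj v w) →
    cost α σ v ≤ cost α (Function.update σ v s) v

/-- Social cost of a strategy profile. -/
noncomputable def SC [Fintype V] (α : ℝ) (σ : V → Finset V) : ℝ≥0∞ :=
  ∑ v, cost α σ v

end NCG

namespace NCG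

open SimpleGraph

variable {V : Type*}

lemma created_adj {σ : V → Finset V} {u v : V} :
    (created σ).Adj u v ↔ u ≠ v ∧ (v ∈ σ u ∨ u ∈ σ v) := by
  simp [created, SimpleGraph.fromRel_adj]

/-- In a connected graph every vertex other than `c` has a neighbor one step closer to `c`. -/
lemma exists_parent {G : SimpleGraph V} (hG : G.Connected) (c : V) :
    ∃ p : V → V, ∀ x, x ≠ c → G.Adj x (p x) ∧ G.dist (p x) c + 1 = G.dist x c := by
  have key : ∀ x, ∃ y, x ≠ c → G.Adj x y ∧ G.dist y c + 1 = G.dist x c := by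
    intro x
    by_cases hx : x = c
    · exact ⟨x, fun h => absurd hx h⟩
    obtain ⟨w, hw⟩ := hG.exists_walk_length_eq_dist x c
    cases w with
    | nil => exact absurd rfl hx
    | @cons _ y _ h w =>
      refine ⟨y, fun _ => ⟨h, ?_⟩⟩
      have h1 := dist_le w
      have h2 := hG.dist_triangle (u := x) (v := y) (w := c)
      rw [dist_eq_one_iff_adj.2 h] at h2
      rw [Walk.length_cons] at hw
      omega
  choose p hp using key
  exact ⟨p, hp⟩

/-- A graph containing all parent edges of a shortest-path tree of `G` rooted at `c` has
distances to `c` at most those of `G`. -/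
lemma edist_le_of_parent {G G' : SimpleGraph V} (hG : G.Connected) {c : V} {p : V → V}
    (hp : ∀ x, x ≠ c → G.dist (p x) c + 1 = G.dist x c)
    (hp' : ∀ x, x ≠ c → G'.Adj x (p x)) (x : V) : G'.edist x c ≤ G.edist x c := by
  rw [← (hG x c).coe_dist_eq_edist]
  induction hn : G.dist x c generalizing x with
  | zero => simp [hG.dist_eq_zero_iff.1 hn]
  | succ n ih =>
    have hx : x ≠ c := by
      rintro rfl
      simp at hn
    have h1 := ih (p x) (by have := hp x hx; omega)
    have h2 : G'.edist x (p x) = 1 := edist_eq_one_iff_adj.2 (hp' x hx)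
    calc G'.edist x c ≤ G'.edist x (p x) + G'.edist (p x) c := SimpleGraph.edist_triangle
      _ ≤ 1 + n := by rw [h2]; gcongr
      _ = _ := by push_cast; rw [add_comm]

lemma ecc_le_two_mul {G G' : SimpleGraph V} {c : V}
    (h : ∀ x, G'.edist x c ≤ G.edist x c) (v : V) : ecc G' v ≤ 2 * ecc G c := by
  have h' : ∀ x, G'.edist x c ≤ ecc G c := fun x =>
    (h x).trans (by rw [SimpleGraph.edist_comm]; exact le_iSup (G.edist c) x)
  refine iSup_le fun u => ?_
  calc G'.edist v u ≤ G'.edist v c + G'.edist c u := SimpleGraph.edist_triangle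
    _ ≤ ecc G c + ecc G c := add_le_add (h' v) (by rw [SimpleGraph.edist_comm]; exact h' u)
    _ = _ := (two_mul _).symm

/-- If ordered pairs `(a x, b x)`, for `x ≠ c`, are bought edges forming the parent edges of a
shortest-path tree rooted at `c`, then no player pays more at equilibrium than for its own
tree edges plus twice the eccentricity of `c`. -/
lemma cost_le_of_tree [Fintype V] [DecidableEq V] {H : SimpleGraph V} {α : ℝ}
    {σ : V → Finset V} (hNE : IsNE H α σ) (hconn : (created σ).Connected) {c : V}
    {p a b : V → V} (hp : ∀ x, x ≠ c → (created σ).dist (p x) c + 1 = (created σ).dist x c)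
    (hab : ∀ x, x ≠ c → b x ∈ σ (a x) ∧ s(a x, b x) = s(x, p x)) (v : V) :
    cost α σ v ≤ ENNReal.ofReal α * ((({c}ᶜ : Finset V).filter (fun x => a x = v)).card : ℝ≥0∞) +
      2 * (ecc (created σ) c : ℝ≥0∞) := by
  set s : Finset V := (({c}ᶜ : Finset V).filter (fun x => a x = v)).image b with hs
  have hsH : ∀ w ∈ s, H.Adj v w := by
    intro w hw
    simp only [hs, Finset.mem_image, Finset.mem_filter, Finset.mem_compl,
      Finset.mem_singleton] at hw
    obtain ⟨x, ⟨hx, rfl⟩, rfl⟩ := hw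
    exact hNE.1 _ _ (hab x hx).1
  have hadj : ∀ x, x ≠ c → (created (Function.update σ v s)).Adj x (p x) := by
    intro x hx
    obtain ⟨hb, he⟩ := hab x hx
    rw [← SimpleGraph.mem_edgeSet, ← he, SimpleGraph.mem_edgeSet, created_adj]
    refine ⟨(hNE.1 _ _ hb).ne, Or.inl ?_⟩
    by_cases hv : a x = v
    · rw [hv, Function.update_self]
      exact Finset.mem_image_of_mem b (by simp [hx, hv])
    · rwa [Function.update_of_ne hv]
  have hecc : ecc (created (Function.update σ v s)) v ≤ 2 * ecc (created σ) c :=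
    ecc_le_two_mul (edist_le_of_parent hconn hp hadj) v
  refine (hNE.2 v s hsH).trans ?_
  unfold cost
  rw [Function.update_self]
  refine add_le_add (mul_le_mul' le_rfl (Nat.cast_le.2 Finset.card_image_le)) ?_
  calc _ ≤ ((2 * ecc (created σ) c : ℕ∞) : ℝ≥0∞) := ENat.toENNReal_le.2 hecc
    _ = _ := by simp

end NCG

/-- At a connected Nash equilibrium,
`SC(σ) ≤ α·(n−1) + 2·n·ρ_{G(σ)}`. -/
theorem social_cost_le_at_equilibrium
    {V : Type*} [Fintype V] [DecidableEq V]
    (H : SimpleGraph V) (hH : H.Connected) (α : ℝ) (hα : 0 ≤ α)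
    (σ : V → Finset V) (hNE : NCG.IsNE H α σ)
    (hconn : (NCG.created σ).Connected) :
    NCG.SC α σ ≤ ENNReal.ofReal α * ((Fintype.card V - 1 : ℕ) : ℝ≥0∞) +
      2 * (Fintype.card V : ℝ≥0∞) * (NCG.radius (NCG.created σ) : ℝ≥0∞) := by
  have := hconn.nonempty
  obtain ⟨c, hc⟩ : ∃ c, NCG.ecc (NCG.created σ) c = NCG.radius (NCG.created σ) :=
    ENat.exists_eq_iInf _
  obtain ⟨p, hp⟩ := NCG.exists_parent hconn c
  have key : ∀ x, ∃ e : V × V, x ≠ c → e.2 ∈ σ e.1 ∧ s(e.1, e.2) = s(x, p x) := by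
    intro x
    by_cases hx : x = c
    · exact ⟨(x, x), fun h => absurd hx h⟩
    rcases (NCG.created_adj.1 (hp x hx).1).2 with h | h
    · exact ⟨(x, p x), fun _ => ⟨h, rfl⟩⟩
    · exact ⟨(p x, x), fun _ => ⟨h, Sym2.eq_swap⟩⟩
  choose e he using key
  have hcard : ∑ v, (({c}ᶜ : Finset V).filter (fun x => (e x).1 = v)).card =
      Fintype.card V - 1 := by
    rw [← Finset.card_eq_sum_card_fiberwise (fun _ _ => Finset.mem_coe.2 (Finset.mem_univ _)),
      Finset.card_compl, Finset.card_singleton]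
  calc NCG.SC α σ ≤ ∑ v, (ENNReal.ofReal α *
        ((({c}ᶜ : Finset V).filter (fun x => (e x).1 = v)).card : ℝ≥0∞) +
        2 * (NCG.ecc (NCG.created σ) c : ℝ≥0∞)) :=
        Finset.sum_le_sum fun v _ => NCG.cost_le_of_tree hNE hconn (fun x hx => (hp x hx).2) he v
    _ = _ := by
      rw [Finset.sum_add_distrib, ← Finset.mul_sum, ← Nat.cast_sum, hcard, hc,
        Finset.sum_const, Finset.card_univ, nsmul_eq_mul]
      ring
end

section
/- Let H be a connected simple graph on n ≥ 2 vertices with |E(H)| = n − 1 + h for an integer h ≥ 0, and let α ≥ 0. Let σ be a Nash equilibrium of the max-distance network creation game on H such that G(σ) is connected, and let τ be any strategy profile such that G(τ) is connected. Then SC(σ) ≤ 4·(h + 1)·SC(τ). (This makes precise the result that for host graphs with n − 1 + h edges the PoA is O(h + 1).) -/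
open scoped ENNReal Classical

namespace NCG

section Graph

variable {V : Type*}

/-- In a connected graph every vertex other than `c` has a neighbour one step closer to `c`. -/
lemma exists_adj_dist_succ {G : SimpleGraph V} (hG : G.Connected) {c x : V} (hx : x ≠ c) :
    ∃ y, G.Adj x y ∧ G.dist y c + 1 = G.dist x c := by
  obtain ⟨p, hp⟩ := hG.exists_walk_length_eq_dist x c
  cases p with
  | nil => exact absurd rfl hx
  | cons hxy q =>
    rename_i y
    refine ⟨y, hxy, le_antisymm ?_ ?_⟩
    · rw [← hp, SimpleGraph.Walk.length_cons]
      exact Nat.succ_le_succ (SimpleGraph.dist_le q)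
    · have h1 := hG.dist_triangle (u := x) (v := y) (w := c)
      rw [SimpleGraph.dist_eq_one_iff_adj.mpr hxy] at h1
      omega

/-- All distances up to `G.dist u c` are attained as distances to `c`. -/
lemma exists_dist_eq {G : SimpleGraph V} (hG : G.Connected) (c u : V) {i : ℕ}
    (hi : i ≤ G.dist u c) : ∃ x, G.dist x c = i := by
  induction hd : G.dist u c generalizing u with
  | zero => exact ⟨u, by omega⟩
  | succ d ih =>
    rcases Nat.lt_or_ge d i with hlt | hle
    · exact ⟨u, by omega⟩
    · have hne : u ≠ c := by
        rintro rfl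
        simp at hd
      obtain ⟨y, -, hy⟩ := exists_adj_dist_succ hG hne
      exact ih y (by omega) (by omega)

/-- A connected graph covered by the balls of radius `r` around `S` has all distances less than
`#S * (2 * r + 1)`. -/
lemma dist_lt_of_cover {G : SimpleGraph V} (hG : G.Connected) (S : Finset V) (r : ℕ)
    (hS : ∀ x, ∃ a ∈ S, G.dist x a ≤ r) (u v : V) :
    G.dist u v < S.card * (2 * r + 1) := by
  choose f hfS hf using hS
  have := hG.nonempty
  choose! x hx using fun i => exists_dist_eq hG v u (i := i)
  set L := G.dist u v
  have hfib : ∀ a ∈ S, ((Finset.range (L + 1)).filter (fun i => f (x i) = a)).card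
      ≤ 2 * r + 1 := by
    intro a _
    set F := (Finset.range (L + 1)).filter (fun i => f (x i) = a)
    rcases F.eq_empty_or_nonempty with hF | hF
    · simp [hF]
    have hsub : F ⊆ Finset.Icc (F.min' hF) (F.min' hF + 2 * r) := by
      intro j hj
      refine Finset.mem_Icc.mpr ⟨F.min'_le j hj, ?_⟩
      have hi := F.min'_mem hF
      set i := F.min' hF
      simp only [F, Finset.mem_filter, Finset.mem_range] at hi hj
      have h1 := hf (x i)
      have h2 := hf (x j)
      rw [hi.2] at h1
      rw [hj.2] at h2
      have h3 := hG.dist_triangle (u := x j) (v := a) (w := x i)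
      have h4 := hG.dist_triangle (u := x j) (v := x i) (w := v)
      rw [hx i (by omega), hx j (by omega)] at h4
      rw [SimpleGraph.dist_comm (u := a)] at h3
      omega
    calc F.card ≤ (Finset.Icc (F.min' hF) (F.min' hF + 2 * r)).card := Finset.card_le_card hsub
      _ = 2 * r + 1 := by rw [Nat.card_Icc]; omega
  have := Finset.card_le_mul_card_image_of_maps_to
    (s := Finset.range (L + 1)) (t := S) (f := fun i => f (x i)) (fun i _ => hfS _) _ hfib
  rw [Finset.card_range] at this
  calc L < L + 1 := Nat.lt_succ_self L
    _ ≤ _ := this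
    _ = _ := Nat.mul_comm _ _

/-- If a connected graph `G` misses at most `h` edges of a connected graph `T`, then distances in
`G` are less than `(h + 1) * (2 * r + 1)`, where `r` bounds the distances from some `c` in `T`. -/
lemma dist_lt_of_ncard_diff_le [Finite V] {G T : SimpleGraph V} (hG : G.Connected)
    (hT : T.Connected) {h r : ℕ} (hd : (T.edgeSet \ G.edgeSet).ncard ≤ h) (c : V)
    (hr : ∀ x, T.dist x c ≤ r) (u v : V) :
    G.dist u v < (h + 1) * (2 * r + 1) := by
  have := Fintype.ofFinite V
  let A : Finset V := Finset.univ.filter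
    (fun a => ∃ b, T.Adj a b ∧ ¬ G.Adj a b ∧ T.dist b c + 1 = T.dist a c)
  have hA : A.card ≤ h := by
    have hb : ∀ a ∈ A, ∃ b, T.Adj a b ∧ ¬ G.Adj a b ∧ T.dist b c + 1 = T.dist a c :=
      fun a ha => (Finset.mem_filter.mp ha).2
    choose! b hTb hGb hdb using hb
    refine le_trans ?_ hd
    rw [← Set.ncard_coe_finset]
    refine Set.ncard_le_ncard_of_injOn (fun a => s(a, b a)) ?_ ?_
    · intro a ha
      exact ⟨hTb a ha, hGb a ha⟩
    · intro a ha a' ha' heq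
      rcases Sym2.eq_iff.mp heq with ⟨h1, -⟩ | ⟨h1, h2⟩
      · exact h1
      · have e1 := hdb a ha
        have e2 := hdb a' ha'
        rw [h2] at e1
        rw [← h1] at e2
        omega
  have hcover : ∀ n x, T.dist x c = n → ∃ a ∈ insert c A, G.dist x a ≤ n := by
    intro n
    induction n with
    | zero =>
      intro x hx
      obtain rfl : x = c := hT.dist_eq_zero_iff.mp hx
      exact ⟨x, Finset.mem_insert_self _ _, by simp⟩
    | succ n ih =>
      intro x hx
      have hne : x ≠ c := by
        rintro rfl
        simp at hx
      obtain ⟨y, hxy, hy⟩ := exists_adj_dist_succ hT hne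
      by_cases hGxy : G.Adj x y
      · obtain ⟨a, ha, hya⟩ := ih y (by omega)
        have h1 := hG.dist_triangle (u := x) (v := y) (w := a)
        rw [SimpleGraph.dist_eq_one_iff_adj.mpr hGxy] at h1
        exact ⟨a, ha, by omega⟩
      · exact ⟨x, Finset.mem_insert_of_mem
          (Finset.mem_filter.mpr ⟨Finset.mem_univ _, y, hxy, hGxy, hy⟩), by simp⟩
  refine (dist_lt_of_cover hG (insert c A) r (fun x => ?_) u v).trans_le ?_
  · obtain ⟨a, ha, hxa⟩ := hcover _ x rfl
    exact ⟨a, ha, hxa.trans (hr x)⟩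
  · exact Nat.mul_le_mul_right _ ((Finset.card_insert_le _ _).trans (by omega))

lemma ecc_ne_top [Finite V] {G : SimpleGraph V} (hG : G.Connected) (v : V) : ecc G v ≠ ⊤ := by
  have := hG.nonempty
  obtain ⟨u, hu⟩ := exists_eq_ciSup_of_finite (f := fun u => G.edist v u)
  rw [ecc, ← hu]
  exact SimpleGraph.edist_ne_top_iff_reachable.mpr (hG v u)

lemma dist_le_toNat_ecc [Finite V] {G : SimpleGraph V} (hG : G.Connected) (u v : V) :
    G.dist u v ≤ (ecc G v).toNat := by
  rw [SimpleGraph.dist_comm]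
  exact ENat.toNat_le_toNat (le_iSup (fun u => G.edist v u) u) (ecc_ne_top hG v)

lemma ecc_le_mul_ecc [Finite V] [Nontrivial V] {G T : SimpleGraph V} (hG : G.Connected)
    (hT : T.Connected) {h : ℕ} (hd : (T.edgeSet \ G.edgeSet).ncard ≤ h) (v : V) :
    ecc G v ≤ 4 * (h + 1) * ecc T v := by
  obtain ⟨r, hr⟩ := ENat.ne_top_iff_exists.mp (ecc_ne_top hT v)
  have hle : ∀ x, T.dist x v ≤ r := fun x => by
    simpa [← hr] using dist_le_toNat_ecc hT x v
  have hr0 : 1 ≤ r := by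
    obtain ⟨w, hw⟩ := exists_ne v
    exact (hT.pos_dist_of_ne hw).trans_le (hle w)
  refine iSup_le fun u => ?_
  rw [← (hG v u).coe_dist_eq_edist, ← hr]
  have := dist_lt_of_ncard_diff_le hG hT hd v hle v u
  have hfin : G.dist v u ≤ 4 * (h + 1) * r := by nlinarith
  exact_mod_cast hfin

end Graph

section Profile

variable {V : Type*}

lemma mem_edgeSet_created {σ : V → Finset V} {u v : V} :
    s(u, v) ∈ (created σ).edgeSet ↔ u ≠ v ∧ (v ∈ σ u ∨ u ∈ σ v) := by
  simp [created]

lemma created_le {H : SimpleGraph V} {σ : V → Finset V} (hσ : Valid H σ) : created σ ≤ H := by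
  intro u v huv
  rcases ((SimpleGraph.fromRel_adj _ _ _).mp huv).2 with h | h
  · exact hσ u v h
  · exact (hσ v u h).symm

/-- The edges of the created graph are bought by at least one player. -/
lemma ncard_edgeSet_created_le [Fintype V] (σ : V → Finset V) :
    (created σ).edgeSet.ncard ≤ ∑ v, (σ v).card := by
  rw [← Finset.card_sigma]
  refine le_trans (Set.ncard_le_ncard (t := ((Finset.univ.sigma σ).image
    (fun p => s(p.1, p.2)) : Finset (Sym2 V))) ?_ (Finset.finite_toSet _)) ?_
  · intro e
    induction e with
    | h u v =>
      rw [mem_edgeSet_created]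
      rintro ⟨-, h | h⟩
      · exact Finset.mem_coe.mpr (Finset.mem_image.mpr ⟨⟨u, v⟩, by simpa using h, rfl⟩)
      · exact Finset.mem_coe.mpr (Finset.mem_image.mpr ⟨⟨v, u⟩, by simpa using h, Sym2.eq_swap⟩)
  · rw [Set.ncard_coe_finset]
    exact Finset.card_image_le

/-- When edges have positive price, no edge is bought twice in a connected equilibrium. -/
lemma IsNE.notMem_of_mem [Finite V] [DecidableEq V] {H : SimpleGraph V} {α : ℝ}
    {σ : V → Finset V} (hNE : IsNE H α σ) (hα : 0 < α) (hσ : (created σ).Connected) {v w : V}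
    (hw : w ∈ σ v) : v ∉ σ w := by
  intro hv
  have hvw : w ≠ v := (hNE.1 v w hw).ne'
  have hcr : created (Function.update σ v ((σ v).erase w)) = created σ := by
    ext a b
    simp only [created, SimpleGraph.fromRel_adj, Function.update_apply]
    grind
  have hcost := hNE.2 v ((σ v).erase w) fun x hx => hNE.1 v x (Finset.mem_of_mem_erase hx)
  rw [cost, cost, hcr, Function.update_self] at hcost
  have hfin : (ecc (created σ) v : ℝ≥0∞) ≠ ⊤ := by
    simpa using ecc_ne_top hσ v
  have h1 := (ENNReal.add_le_add_iff_right hfin).mp hcost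
  have h2 := (ENNReal.mul_le_mul_iff_right (ENNReal.ofReal_pos.mpr hα).ne'
    ENNReal.ofReal_ne_top).mp h1
  have h3 : (σ v).card ≤ ((σ v).erase w).card := by exact_mod_cast h2
  exact absurd h3 (not_le.mpr (Finset.card_erase_lt_of_mem hw))

lemma IsNE.sum_card_le [Fintype V] [DecidableEq V] {H : SimpleGraph V} {α : ℝ}
    {σ : V → Finset V} (hNE : IsNE H α σ) (hα : 0 < α) (hσ : (created σ).Connected) :
    ∑ v, (σ v).card ≤ H.edgeSet.ncard := by
  rw [← Finset.card_sigma, ← Set.ncard_coe_finset]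
  refine Set.ncard_le_ncard_of_injOn (fun p => s(p.1, p.2)) ?_ ?_
  · rintro ⟨v, w⟩ hp
    exact hNE.1 v w (by simpa using hp)
  · rintro ⟨v, w⟩ hp ⟨v', w'⟩ hp' heq
    have hw : w ∈ σ v := by simpa using hp
    have hw' : w' ∈ σ v' := by simpa using hp'
    rcases Sym2.eq_iff.mp heq with ⟨h1, h2⟩ | ⟨h1, h2⟩
    · dsimp only at h1 h2
      rw [h1, h2]
    · dsimp only at h1 h2
      subst h1 h2
      exact absurd hw' (hNE.notMem_of_mem hα hσ hw)

end Profile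

end NCG

/-- If the host graph has `n − 1 + h` edges, then for any
connected Nash equilibrium `σ` and any connected profile `τ`,
`SC(σ) ≤ 4·(h + 1)·SC(τ)`; i.e., the PoA is `O(h + 1)`. -/
theorem poa_sparse_host_graph
    {V : Type*} [Fintype V] [DecidableEq V]
    (H : SimpleGraph V) (hH : H.Connected) (hn : 2 ≤ Fintype.card V)
    (h : ℕ) (hE : H.edgeSet.ncard = Fintype.card V - 1 + h)
    (α : ℝ) (hα : 0 ≤ α)
    (σ : V → Finset V) (hNE : NCG.IsNE H α σ)
    (hσconn : (NCG.created σ).Connected)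
    (τ : V → Finset V) (hτ : NCG.Valid H τ)
    (hτconn : (NCG.created τ).Connected) :
    NCG.SC α σ ≤ 4 * ((h : ℝ≥0∞) + 1) * NCG.SC α τ := by
  have : Nontrivial V := Fintype.one_lt_card_iff_nontrivial.mp hn
  have hedges : ∀ {G : SimpleGraph V}, G.Connected → Fintype.card V - 1 ≤ G.edgeSet.ncard := by
    intro G hG
    have := hG.card_vert_le_card_edgeSet_add_one
    rw [Nat.card_eq_fintype_card, Nat.card_coe_set_eq] at this
    omega
  have hdiff : ((NCG.created τ).edgeSet \ (NCG.created σ).edgeSet).ncard ≤ h := by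
    have h1 : ((NCG.created τ).edgeSet \ (NCG.created σ).edgeSet).ncard ≤
        (H.edgeSet \ (NCG.created σ).edgeSet).ncard :=
      Set.ncard_le_ncard (Set.sdiff_subset_sdiff_left
        (SimpleGraph.edgeSet_mono (NCG.created_le hτ))) (Set.toFinite _)
    have h2 := Set.ncard_sdiff_add_ncard_of_subset
      (SimpleGraph.edgeSet_mono (NCG.created_le hNE.1)) (Set.toFinite _)
    have h3 := hedges hσconn
    omega
  have hbuy : ENNReal.ofReal α * ((∑ v, (σ v).card : ℕ) : ℝ≥0∞) ≤
      4 * ((h : ℝ≥0∞) + 1) * (ENNReal.ofReal α * ((∑ v, (τ v).card : ℕ) : ℝ≥0∞)) := by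
    rcases hα.eq_or_lt with rfl | hpos
    · simp
    have h1 := hNE.sum_card_le hpos hσconn
    have h2 := (hedges hτconn).trans (NCG.ncard_edgeSet_created_le τ)
    have h3 : ∑ v, (σ v).card ≤ 4 * (h + 1) * ∑ v, (τ v).card := by
      have h4 : 1 ≤ ∑ v, (τ v).card := by omega
      have h5 : ∑ v, (σ v).card ≤ ∑ v, (τ v).card + h := by omega
      nlinarith
    rw [mul_left_comm]
    gcongr
    exact_mod_cast h3
  have hecc : ∀ v, (NCG.ecc (NCG.created σ) v : ℝ≥0∞) ≤
      4 * ((h : ℝ≥0∞) + 1) * (NCG.ecc (NCG.created τ) v : ℝ≥0∞) := by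
    intro v
    have := ENat.toENNReal_le.mpr (NCG.ecc_le_mul_ecc hσconn hτconn hdiff v)
    simpa using this
  simp only [NCG.SC, NCG.cost, Finset.sum_add_distrib, ← Finset.mul_sum, ← Nat.cast_sum]
  rw [mul_add]
  refine add_le_add hbuy ?_
  rw [Finset.mul_sum]
  exact Finset.sum_le_sum fun v _ => hecc v
end

section
/- Let H be a connected simple graph, let α ≥ 0, and let σ be a Nash equilibrium of the max-distance network creation game on H such that G = G(σ) is connected. Then for every edge {u,v} ∈ E(H), the eccentricities of u and v in G satisfy |ε_G(u) − ε_G(v)| ≤ 1 + α. -/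
open scoped ENNReal Classical

namespace NCG

variable {V : Type*}

theorem ecc_anti {G G' : SimpleGraph V} (h : G ≤ G') (v : V) : ecc G' v ≤ ecc G v :=
  iSup_mono fun _ => SimpleGraph.edist_anti h

theorem ecc_le_ecc_add_one {G : SimpleGraph V} {u v : V} (h : G.Adj u v) :
    ecc G u ≤ ecc G v + 1 := by
  refine iSup_le fun w => ?_
  calc G.edist u w ≤ G.edist u v + G.edist v w := G.edist_triangle
    _ = G.edist v w + 1 := by rw [SimpleGraph.edist_eq_one_iff_adj.mpr h, add_comm]
    _ ≤ ecc G v + 1 := by gcongr; exact le_iSup (fun x => G.edist v x) w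

theorem created_mono {σ τ : V → Finset V} (h : ∀ v, σ v ⊆ τ v) : created σ ≤ created τ := by
  intro a b hab
  simp only [created, SimpleGraph.fromRel_adj] at hab ⊢
  exact ⟨hab.1, hab.2.imp (fun k => h _ k) (fun k => h _ k)⟩

/-- If buying the edge towards `v` does not pay off for `u`, then the eccentricity of `u` exceeds
that of `v` by at most `1 + α`. -/
theorem IsNE.ecc_le_of_adj [DecidableEq V] {H : SimpleGraph V} {α : ℝ} {σ : V → Finset V}
    (hNE : IsNE H α σ) {u v : V} (huv : H.Adj u v) :
    (ecc (created σ) u : ℝ≥0∞) ≤ (ecc (created σ) v : ℝ≥0∞) + (1 + ENNReal.ofReal α) := by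
  have hdev := hNE.2 u (insert v (σ u)) fun w hw => by
    rcases Finset.mem_insert.mp hw with rfl | hw
    · exact huv
    · exact hNE.1 u w hw
  set τ := Function.update σ u (insert v (σ u)) with hτ
  have hτu : τ u = insert v (σ u) := by simp [hτ]
  have hsub : ∀ w, σ w ⊆ τ w := by
    intro w
    rcases eq_or_ne w u with rfl | hw
    · rw [hτu]; exact Finset.subset_insert _ _
    · simp [hτ, hw]
  have hadj : (created τ).Adj u v := by
    simp [created, hτu, huv.ne]
  have hecc : (ecc (created τ) u : ℝ≥0∞) ≤ (ecc (created σ) v : ℝ≥0∞) + 1 := by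
    exact_mod_cast (ecc_le_ecc_add_one hadj).trans
      (add_le_add_left (ecc_anti (created_mono hsub) v) 1)
  have hcard : ((τ u).card : ℝ≥0∞) ≤ (σ u).card + 1 := by
    rw [hτu]
    exact_mod_cast Finset.card_insert_le v (σ u)
  have hfin : ENNReal.ofReal α * ((σ u).card : ℝ≥0∞) ≠ ∞ :=
    ENNReal.mul_ne_top ENNReal.ofReal_ne_top (ENNReal.natCast_ne_top _)
  refine (ENNReal.add_le_add_iff_left hfin).mp ?_
  calc _ ≤ ENNReal.ofReal α * (τ u).card + (ecc (created τ) u : ℝ≥0∞) := hdev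
    _ ≤ ENNReal.ofReal α * ((σ u).card + 1) + ((ecc (created σ) v : ℝ≥0∞) + 1) := by gcongr
    _ = _ := by ring

end NCG

/-- At a connected Nash equilibrium, eccentricities of
`H`-adjacent vertices differ by at most `1 + α`. -/
theorem ecc_diff_le_of_adj
    {V : Type*} [Fintype V] [DecidableEq V]
    (H : SimpleGraph V) (hH : H.Connected) (α : ℝ) (hα : 0 ≤ α)
    (σ : V → Finset V) (hNE : NCG.IsNE H α σ)
    (hconn : (NCG.created σ).Connected)
    (u v : V) (huv : H.Adj u v) :
    (NCG.ecc (NCG.created σ) u : ℝ≥0∞) ≤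
        (NCG.ecc (NCG.created σ) v : ℝ≥0∞) + (1 + ENNReal.ofReal α) ∧
    (NCG.ecc (NCG.created σ) v : ℝ≥0∞) ≤
        (NCG.ecc (NCG.created σ) u : ℝ≥0∞) + (1 + ENNReal.ofReal α) := by
  exact ⟨hNE.ecc_le_of_adj huv, hNE.ecc_le_of_adj huv.symm⟩
end

section
/- For every integer k ≥ 1, every vertex of the rotated torus T_k has eccentricity in T_k exactly equal to k. -/
open scoped ENNReal

/-- Vertices of the rotated torus: pairs `(i,j) ∈ ℤ_{2k} × ℤ_{2k}` with
`i + j` even. -/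
def TorusVert (k : ℕ) : Type :=
  {x : ZMod (2 * k) × ZMod (2 * k) // Even (x.1 + x.2)}

/-- The 2D-torus-rotated-45°: `(i,j)` is adjacent to the four vertices
`(i ± 1, j ± 1)` (coordinates modulo `2k`). -/
def rotatedTorus (k : ℕ) : SimpleGraph (TorusVert k) :=
  SimpleGraph.fromRel (fun a b =>
    (b.1.1 - a.1.1 = 1 ∨ b.1.1 - a.1.1 = -1) ∧
    (b.1.2 - a.1.2 = 1 ∨ b.1.2 - a.1.2 = -1))

/-- Circular distance on `ℤ_m`: `d̄(a,b) = min{r, m − r}` where `r` is the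
canonical representative of `a − b`. -/
def cdist {m : ℕ} (a b : ZMod m) : ℕ :=
  min (a - b).val (m - (a - b).val)

/-- Eccentricity of a vertex (`⊤` if the graph is disconnected). -/
noncomputable def ecc {V : Type*} (G : SimpleGraph V) (v : V) : ℕ∞ :=
  ⨆ u, G.edist v u

theorem rotatedTorus_adj_iff {k : ℕ} (hk : 1 ≤ k) {a b : TorusVert k} :
    (rotatedTorus k).Adj a b ↔
      (b.1.1 - a.1.1 = 1 ∨ b.1.1 - a.1.1 = -1) ∧ (b.1.2 - a.1.2 = 1 ∨ b.1.2 - a.1.2 = -1) := by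
  have : Fact (1 < 2 * k) := ⟨by omega⟩
  rw [rotatedTorus, SimpleGraph.fromRel_adj]
  constructor
  · rintro ⟨-, h | h⟩
    · exact h
    · rw [← neg_sub a.1.1, ← neg_sub a.1.2]
      simp only [neg_eq_iff_eq_neg, neg_neg]
      exact ⟨h.1.symm, h.2.symm⟩
  · refine fun h => ⟨?_, Or.inl h⟩
    rintro rfl
    simp at h

/-- A walk of length `n` changes the first coordinate by an integer of absolute value at
most `n`. -/
theorem rotatedTorus_walk_fst {k : ℕ} (hk : 1 ≤ k) {v u : TorusVert k}
    (p : (rotatedTorus k).Walk v u) :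
    ∃ z : ℤ, |z| ≤ p.length ∧ u.1.1 - v.1.1 = (z : ZMod (2 * k)) := by
  induction p with
  | nil => exact ⟨0, by simp⟩
  | @cons v w u h p ih =>
    obtain ⟨z, hz, hzu⟩ := ih
    rw [abs_le] at hz
    have hsplit : u.1.1 - v.1.1 = (u.1.1 - w.1.1) + (w.1.1 - v.1.1) := by ring
    obtain ⟨h1 | h1, -⟩ := (rotatedTorus_adj_iff hk).1 h
    · refine ⟨z + 1, ?_, by rw [hsplit, hzu, h1]; push_cast; ring⟩
      rw [abs_le, SimpleGraph.Walk.length_cons]; push_cast; omega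
    · refine ⟨z - 1, ?_, by rw [hsplit, hzu, h1]; push_cast; ring⟩
      rw [abs_le, SimpleGraph.Walk.length_cons]; push_cast; omega

/-- An integer at distance at most `n + 1` from `0`, with the parity of `n + 1`, is one unit step
away from an integer at distance at most `n` with the parity of `n`. -/
theorem exists_unit_step {n : ℕ} {a : ℤ} (ha : |a| ≤ (n + 1 : ℕ)) (hpar : Even (a + (n + 1 : ℕ))) :
    ∃ s : ℤ, (s = 1 ∨ s = -1) ∧ |a - s| ≤ n ∧ Even (a - s + n) := by
  rw [abs_le] at ha
  obtain ⟨r, hr⟩ := hpar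
  push_cast at ha hr
  rcases lt_or_ge 0 a with h | h
  · exact ⟨1, Or.inl rfl, by rw [abs_le]; omega, ⟨r - 1, by omega⟩⟩
  · exact ⟨-1, Or.inr rfl, by rw [abs_le]; omega, ⟨r, by omega⟩⟩

theorem rotatedTorus_edist_le_of_offset {k : ℕ} (hk : 1 ≤ k) (n : ℕ) {v u : TorusVert k} {a b : ℤ}
    (ha : |a| ≤ n) (hb : |b| ≤ n) (hpa : Even (a + n)) (hpb : Even (b + n))
    (h1 : u.1.1 - v.1.1 = (a : ZMod (2 * k))) (h2 : u.1.2 - v.1.2 = (b : ZMod (2 * k))) :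
    (rotatedTorus k).edist v u ≤ n := by
  induction n generalizing v a b with
  | zero =>
    have ha0 : a = 0 := by simpa using ha
    have hb0 : b = 0 := by simpa using hb
    have huv : v = u := by
      refine Subtype.ext (Prod.ext ?_ ?_)
      · rw [ha0, Int.cast_zero] at h1; exact (sub_eq_zero.1 h1).symm
      · rw [hb0, Int.cast_zero] at h2; exact (sub_eq_zero.1 h2).symm
    simp [huv]
  | succ n ih =>
    obtain ⟨s, hs, has, hps⟩ := exists_unit_step ha hpa
    obtain ⟨t, ht, hbt, hpt⟩ := exists_unit_step hb hpb
    have hst : Even (s + t) := by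
      rcases hs with rfl | rfl <;> rcases ht with rfl | rfl <;> decide
    let w : TorusVert k := ⟨(v.1.1 + s, v.1.2 + t), by
      have := v.2.add (hst.map (Int.castRingHom (ZMod (2 * k))))
      simpa [add_add_add_comm] using this⟩
    have hadj : (rotatedTorus k).Adj v w := by
      rw [rotatedTorus_adj_iff hk]
      constructor
      · rcases hs with rfl | rfl <;> simp [w]
      · rcases ht with rfl | rfl <;> simp [w]
    have hw : (rotatedTorus k).edist w u ≤ n := by
      refine ih has hbt hps hpt ?_ ?_
      · rw [Int.cast_sub, ← h1]; simp only [w]; ring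
      · rw [Int.cast_sub, ← h2]; simp only [w]; ring
    calc (rotatedTorus k).edist v u
        ≤ (rotatedTorus k).edist v w + (rotatedTorus k).edist w u :=
          SimpleGraph.edist_triangle
      _ ≤ 1 + n := add_le_add (SimpleGraph.edist_eq_one_iff_adj.2 hadj).le hw
      _ = ((n + 1 : ℕ) : ℕ∞) := by push_cast; ring

theorem even_of_even_intCast_zmod {k : ℕ} {z : ℤ} (h : Even (z : ZMod (2 * k))) : Even z := by
  have h2 := h.map (ZMod.castHom (dvd_mul_right 2 k) (ZMod 2))
  rw [map_intCast] at h2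
  obtain ⟨r, hr⟩ := h2
  rw [CharTwo.add_self_eq_zero] at hr
  exact even_iff_two_dvd.2 (by exact_mod_cast (ZMod.intCast_zmod_eq_zero_iff_dvd z 2).1 hr)

theorem abs_valMinAbs_le {k : ℕ} (hk : 1 ≤ k) (x : ZMod (2 * k)) : |x.valMinAbs| ≤ k := by
  have : NeZero (2 * k) := ⟨by omega⟩
  have h := x.valMinAbs_mem_Ioc
  rw [Set.mem_Ioc] at h
  push_cast at h
  rw [abs_le]
  omega

theorem rotatedTorus_edist_le {k : ℕ} (hk : 1 ≤ k) (v u : TorusVert k) :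
    (rotatedTorus k).edist v u ≤ k := by
  obtain ⟨a, hadef⟩ : ∃ a, a = (u.1.1 - v.1.1).valMinAbs := ⟨_, rfl⟩
  obtain ⟨b, hbdef⟩ : ∃ b, b = (u.1.2 - v.1.2).valMinAbs := ⟨_, rfl⟩
  have ha : |a| ≤ k := hadef ▸ abs_valMinAbs_le hk _
  have hb : |b| ≤ k := hbdef ▸ abs_valMinAbs_le hk _
  have h1 : u.1.1 - v.1.1 = (a : ZMod (2 * k)) := by rw [hadef, ZMod.coe_valMinAbs]
  have h2 : u.1.2 - v.1.2 = (b : ZMod (2 * k)) := by rw [hbdef, ZMod.coe_valMinAbs]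
  have hab : Even (a + b) := by
    apply even_of_even_intCast_zmod (k := k)
    rw [Int.cast_add, ← h1, ← h2, sub_add_sub_comm]
    exact u.2.sub v.2
  obtain ⟨r, hr⟩ := hab
  obtain ⟨n, hn⟩ : ∃ n : ℕ, (n : ℤ) = max |a| |b| :=
    ⟨(max |a| |b|).toNat, Int.toNat_of_nonneg (le_max_of_le_left (abs_nonneg a))⟩
  have hnk : n ≤ k := by
    have := max_le ha hb
    omega
  refine (rotatedTorus_edist_le_of_offset hk n (hn ▸ le_max_left _ _) (hn ▸ le_max_right _ _)
    ?_ ?_ h1 h2).trans (by exact_mod_cast hnk)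
  all_goals
    rw [Int.even_iff]
    rcases abs_cases a with h | h <;> rcases abs_cases b with h' | h' <;> omega

/-- The antipode `v + (k, k)` of a vertex `v`. -/
def TorusVert.antipode {k : ℕ} (v : TorusVert k) : TorusVert k :=
  ⟨(v.1.1 + k, v.1.2 + k), by
    rw [add_add_add_comm]
    exact v.2.add ⟨k, rfl⟩⟩

theorem rotatedTorus_le_edist_antipode {k : ℕ} (hk : 1 ≤ k) (v : TorusVert k) :
    (k : ℕ∞) ≤ (rotatedTorus k).edist v v.antipode := by
  refine le_iInf fun p => ?_
  obtain ⟨z, hz, hzk⟩ := rotatedTorus_walk_fst hk p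
  have hdvd : ((2 * k : ℕ) : ℤ) ∣ z - k := by
    rw [← ZMod.intCast_zmod_eq_zero_iff_dvd, Int.cast_sub, ← hzk]
    simp [TorusVert.antipode]
  obtain ⟨c, hc⟩ := hdvd
  suffices (k : ℤ) ≤ |z| by exact_mod_cast this.trans hz
  have hzc : z = k * (2 * c + 1) := by push_cast at hc; linarith
  have hodd : 1 ≤ |2 * c + 1| := Int.one_le_abs (by omega)
  rw [hzc, abs_mul, Nat.abs_cast]
  exact le_mul_of_one_le_right (by positivity) hodd

/-- every vertex of the rotated torus `T_k` has eccentricity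
exactly `k`. -/
theorem rotatedTorus_ecc (k : ℕ) (hk : 1 ≤ k) (v : TorusVert k) :
    ecc (rotatedTorus k) v = (k : ℕ∞) := by
  exact le_antisymm (iSup_le (rotatedTorus_edist_le hk v))
    ((rotatedTorus_le_edist_antipode hk v).trans
      (le_iSup (fun u => (rotatedTorus k).edist v u) v.antipode))
end
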